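/- Suppose f_0 : A → ℝ satisfies ⟨f_0,h⟩ = Σ_{(i,j)∈A} f_0(i,j)h(i,j) = 0 for every h : A → ℝ with zero line sums with respect to S. Put D = Σ_{(i,j)∈A} f_0(i,j) and E = Σ_{(i,j)∈A} min(f_0(i,j)², (1 − f_0(i,j))²). Let F : A → {0,1} be a nearest-integer rounding of f_0, i.e. (F(i,j) − f_0(i,j))² = min(f_0(i,j)², (1 − f_0(i,j))²) for all (i,j) ∈ A. Then for every g : A → {0,1} having the same line sums as f_0 with respect to S, Σ_{(i,j) ∈ A : g(i,j) ≠ F(i,j)} |2 f_0(i,j) − 1| = D − Σ_{(i,j)∈A} f_0(i,j)² − E. -/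

import Mathlib

open scoped Classical

/-- `(a,b)` is a direction: coprime entries and `a ≥ 0`. -/
def IsDirection (d : ℤ × ℤ) : Prop := Int.gcd d.1 d.2 = 1 ∧ 0 ≤ d.1

/-- The line sum of `f : A → ℝ` along the line `a·j = b·i + t` for the direction
`d = (a,b)`, where `A = {0,…,m−1} × {0,…,n−1}`. -/
noncomputable def lineSum (m n : ℕ) (f : Fin m × Fin n → ℝ) (d : ℤ × ℤ) (t : ℤ) : ℝ :=
  ∑ p ∈ Finset.univ.filter
      (fun p : Fin m × Fin n => d.1 * (p.2 : ℤ) = d.2 * (p.1 : ℤ) + t), f p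

/-- Summing the line sums in a direction `d` over all lines gives the total sum. -/
theorem sum_lineSum (m n : ℕ) (f : Fin m × Fin n → ℝ) (d : ℤ × ℤ) :
    ∑ t ∈ Finset.univ.image (fun p : Fin m × Fin n => d.1 * (p.2 : ℤ) - d.2 * (p.1 : ℤ)),
      lineSum m n f d t = ∑ p, f p := by
  rw [← Finset.sum_fiberwise_of_maps_to (fun p hp => Finset.mem_image_of_mem
    (fun p : Fin m × Fin n => d.1 * (p.2 : ℤ) - d.2 * (p.1 : ℤ)) hp)]
  simp only [lineSum, sub_eq_iff_eq_add']

theorem lineSum_sub (m n : ℕ) (f g : Fin m × Fin n → ℝ) (d : ℤ × ℤ) (t : ℤ) :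
    lineSum m n (fun p => f p - g p) d t = lineSum m n f d t - lineSum m n g d t :=
  Finset.sum_sub_distrib _ _

/-- The excess of the squared distance from `x` to a binary value `u` over the squared
distance to a nearest binary value `v` is `|2x - 1|` if `u ≠ v`, and `0` otherwise. -/
theorem ite_ne_abs_two_mul_sub_one {x u v : ℝ} (hu : u = 0 ∨ u = 1) (hv : v = 0 ∨ v = 1)
    (hround : (v - x) ^ 2 = min (x ^ 2) ((1 - x) ^ 2)) :
    (if u ≠ v then |2 * x - 1| else 0) = (u - x) ^ 2 - min (x ^ 2) ((1 - x) ^ 2) := by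
  have h0 := min_le_left (x ^ 2) ((1 - x) ^ 2)
  have h1 := min_le_right (x ^ 2) ((1 - x) ^ 2)
  rw [← hround] at h0 h1 ⊢
  rcases hu with rfl | rfl <;> rcases hv with rfl | rfl
  · simp
  · rw [if_pos (by norm_num), abs_of_nonneg (by linarith)]
    ring
  · rw [if_pos (by norm_num), abs_of_nonpos (by linarith)]
    ring
  · simp

/-- For a nearest-integer rounding `F` of `f₀` and any binary solution `g`, the sum of
`|2f₀(i,j) − 1|` over the pixels where `g` and `F` differ equals `D − |f₀|² − E`. -/
theorem stmt_6 (m n : ℕ) (hm : 0 < m) (hn : 0 < n)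
    (S : Finset (ℤ × ℤ)) (hS : S.Nonempty) (hSdir : ∀ d ∈ S, IsDirection d)
    (f0 : Fin m × Fin n → ℝ)
    (horth : ∀ h : Fin m × Fin n → ℝ,
      (∀ d ∈ S, ∀ t : ℤ, lineSum m n h d t = 0) →
      ∑ p : Fin m × Fin n, f0 p * h p = 0)
    (D E : ℝ)
    (hD : D = ∑ p : Fin m × Fin n, f0 p)
    (hE : E = ∑ p : Fin m × Fin n, min ((f0 p) ^ 2) ((1 - f0 p) ^ 2))
    (F : Fin m × Fin n → ℝ) (hF01 : ∀ p, F p = 0 ∨ F p = 1)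
    (hFround : ∀ p : Fin m × Fin n,
      (F p - f0 p) ^ 2 = min ((f0 p) ^ 2) ((1 - f0 p) ^ 2)) :
    ∀ g : Fin m × Fin n → ℝ, (∀ p, g p = 0 ∨ g p = 1) →
      (∀ d ∈ S, ∀ t : ℤ, lineSum m n g d t = lineSum m n f0 d t) →
      ∑ p ∈ Finset.univ.filter (fun p : Fin m × Fin n => g p ≠ F p),
          |2 * f0 p - 1| = D - ∑ p : Fin m × Fin n, (f0 p) ^ 2 - E := by
  intro g hg hgs
  obtain ⟨d, hd⟩ := hS
  have hsum : ∑ p, g p = D := by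
    rw [hD, ← sum_lineSum m n g d, ← sum_lineSum m n f0 d]
    exact Finset.sum_congr rfl fun t _ => hgs d hd t
  have hperp := horth (fun p => g p - f0 p) fun d hd t => by
    rw [lineSum_sub, hgs d hd t, sub_self]
  have hsq : ∀ p, (g p - f0 p) ^ 2 = g p - f0 p ^ 2 - 2 * (f0 p * (g p - f0 p)) := fun p => by
    rcases hg p with h | h <;> rw [h] <;> ring
  rw [Finset.sum_filter,
    Finset.sum_congr rfl fun p _ => ite_ne_abs_two_mul_sub_one (hg p) (hF01 p) (hFround p),
    Finset.sum_sub_distrib, ← hE, Finset.sum_congr rfl fun p _ => hsq p,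
    Finset.sum_sub_distrib, Finset.sum_sub_distrib, ← Finset.mul_sum, hperp, hsum]
  ring
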